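/- For every n>1, for K_n and M_n as in the defining conditions (KLTL section), for every HyperCTL* formula ψ and path assignment Π with |Π|+|ψ|<n, for all positions ℓ ≤ i_F (where i_F is the first position of the pure macro-block bl_alert whose last position is i_alert), and every variable x: Π,x,ℓ ⊨_{K_n} ψ if and only if Π,x,ℓ ⊨_{M_n} ψ. -/

import Mathlib

/-- A tree structure: a Kripke structure whose state set is a prefix-closed set of
words over ℕ, with root `[]` as initial state and edges only from a node `τ` to
children `τ ++ [i]`. -/
structure TreeKripke (AP : Type) where
  nodes : Set (List ℕ)
  root_mem : ([] : List ℕ) ∈ nodes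
  prefix_closed : ∀ ⦃τ τ' : List ℕ⦄, τ ∈ nodes → τ' <+: τ → τ' ∈ nodes
  edge : List ℕ → List ℕ → Prop
  edge_mem_l : ∀ ⦃τ τ' : List ℕ⦄, edge τ τ' → τ ∈ nodes
  edge_mem_r : ∀ ⦃τ τ' : List ℕ⦄, edge τ τ' → τ' ∈ nodes
  edge_child : ∀ ⦃τ τ' : List ℕ⦄, edge τ τ' → ∃ i, τ' = τ ++ [i]
  total : ∀ τ ∈ nodes, ∃ τ', edge τ τ'
  V : List ℕ → Set AP

/-- `pa` is an initial path of the tree structure `T`. -/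
def TreeKripke.TInit {AP : Type} (T : TreeKripke AP) (pa : ℕ → List ℕ) : Prop :=
  pa 0 = [] ∧ ∀ i, T.edge (pa i) (pa (i + 1))

/-- A Kripke structure whose states are natural numbers (used to define unwindings,
and hence regular tree structures). -/
structure NKripke (AP : Type) where
  states : Set ℕ
  s0 : ℕ
  s0_mem : s0 ∈ states
  E : ℕ → ℕ → Prop
  E_mem : ∀ ⦃s t⦄, E s t → s ∈ states ∧ t ∈ states
  total : ∀ s ∈ states, ∃ t, E s t
  V : ℕ → Set AP

/-- A tree structure is regular if it is the unwinding of a finite Kripke structure: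
its nodes are the finite paths from the initial state (coded by the lists of visited
states), all parent-child pairs are edges, and labels come from the labels of the
corresponding states. -/
def IsRegularTree {AP : Type} (T : TreeKripke AP) : Prop :=
  ∃ K : NKripke AP, K.states.Finite ∧
    T.nodes = {τ : List ℕ | List.Chain' K.E (K.s0 :: τ)} ∧
    (∀ τ τ', T.edge τ τ' ↔ (τ ∈ T.nodes ∧ τ' ∈ T.nodes ∧ ∃ i, τ' = τ ++ [i])) ∧
    (∀ τ ∈ T.nodes, T.V τ = K.V ((K.s0 :: τ).getLast (List.cons_ne_nil _ _)))
/-- Syntax of HyperCTL* over atomic propositions `AP` and path variables `Var`. -/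
inductive HCTLs (AP Var : Type) where
  | tt : HCTLs AP Var
  | atom : AP → Var → HCTLs AP Var
  | neg : HCTLs AP Var → HCTLs AP Var
  | conj : HCTLs AP Var → HCTLs AP Var → HCTLs AP Var
  | next : HCTLs AP Var → HCTLs AP Var
  | untl : HCTLs AP Var → HCTLs AP Var → HCTLs AP Var
  | ex : Var → HCTLs AP Var → HCTLs AP Var

/-- All atoms `p[x]` use variables from `B` (bound variables), recursively. -/
def HCTLs.closedIn {AP Var : Type} : HCTLs AP Var → Set Var → Prop
  | .tt, _ => True
  | .atom _ x, B => x ∈ B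
  | .neg φ, B => φ.closedIn B
  | .conj φ ψ, B => φ.closedIn B ∧ ψ.closedIn B
  | .next φ, B => φ.closedIn B
  | .untl φ ψ, B => φ.closedIn B ∧ ψ.closedIn B
  | .ex x φ, B => φ.closedIn (insert x B)

/-- A HyperCTL* sentence: every temporal modality is in the scope of a path quantifier
and every atom `p[x]` has `x` bound by a path quantifier. -/
def HCTLs.isSentence {AP Var : Type} : HCTLs AP Var → Prop
  | .tt => True
  | .atom _ _ => False
  | .neg φ => φ.isSentence
  | .conj φ ψ => φ.isSentence ∧ ψ.isSentence
  | .next _ => False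
  | .untl _ _ => False
  | .ex x φ => φ.closedIn {x}

/-- No path quantifiers occur in the formula. -/
def HCTLs.quantFree {AP Var : Type} : HCTLs AP Var → Prop
  | .tt => True
  | .atom _ _ => True
  | .neg φ => φ.quantFree
  | .conj φ ψ => φ.quantFree ∧ ψ.quantFree
  | .next φ => φ.quantFree
  | .untl φ ψ => φ.quantFree ∧ ψ.quantFree
  | .ex _ _ => False

/-- Prenex form: a block of path quantifiers (existential, or universal encoded as
`¬∃¬`) followed by a quantifier-free formula. -/
inductive HCTLs.prenex {AP Var : Type} : HCTLs AP Var → Prop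
  | qf {φ : HCTLs AP Var} : φ.quantFree → φ.prenex
  | exq {x : Var} {φ : HCTLs AP Var} : φ.prenex → (HCTLs.ex x φ).prenex
  | allq {x : Var} {φ : HCTLs AP Var} :
      φ.prenex → (HCTLs.neg (HCTLs.ex x (HCTLs.neg φ))).prenex

/-- A HyperLTL sentence: a HyperCTL* sentence in prenex form. -/
def HCTLs.isHyperLTL {AP Var : Type} (φ : HCTLs AP Var) : Prop :=
  φ.prenex ∧ φ.isSentence

/-- Size of a HyperCTL* formula. -/
def HCTLs.size {AP Var : Type} : HCTLs AP Var → ℕ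
  | .tt => 1
  | .atom _ _ => 1
  | .neg φ => φ.size + 1
  | .conj φ ψ => φ.size + ψ.size + 1
  | .next φ => φ.size + 1
  | .untl φ ψ => φ.size + ψ.size + 1
  | .ex _ φ => φ.size + 1
/-- Satisfaction of HyperCTL* over a tree structure `T` (paths are raw sequences of
nodes). -/
def HCTLs.satT {AP Var : Type} [DecidableEq Var] (T : TreeKripke AP) :
    HCTLs AP Var → (Var → (ℕ → List ℕ)) → Var → ℕ → Prop
  | .tt, _, _, _ => True
  | .atom p x, A, _, i => p ∈ T.V (A x i)
  | .neg φ, A, y, i => ¬ HCTLs.satT T φ A y i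
  | .conj φ ψ, A, y, i => HCTLs.satT T φ A y i ∧ HCTLs.satT T ψ A y i
  | .next φ, A, y, i => HCTLs.satT T φ A y (i + 1)
  | .untl φ ψ, A, y, i => ∃ j, i ≤ j ∧ HCTLs.satT T ψ A y j ∧
      ∀ k, i ≤ k → k < j → HCTLs.satT T φ A y k
  | .ex x φ, A, y, i => ∃ pa, T.TInit pa ∧ (∀ j, j ≤ i → pa j = A y j) ∧
      HCTLs.satT T φ (Function.update A x pa) x i

/-- `T ⊨ φ` for HyperCTL* over a tree structure `T`. -/
def HCTLs.modelsT {AP Var : Type} [DecidableEq Var] (T : TreeKripke AP)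
    (φ : HCTLs AP Var) : Prop :=
  ∃ (A : Var → (ℕ → List ℕ)) (y : Var), (∀ x, T.TInit (A x)) ∧ HCTLs.satT T φ A y 0
/-- An `n`-block: a word in `{p}∅^*` of length at least `n+2`. -/
def IsNBlock (n : ℕ) (b : List Bool) : Prop :=
  n + 2 ≤ b.length ∧ b = true :: List.replicate (b.length - 1) false

/-- Positionwise union of two equal-length words. -/
def join2 (a b : List Bool) : List Bool := List.zipWith (· || ·) a b

/-- `joinUpTo w k = join(w_1, …, w_k)` (for `k ≥ 1`). -/
def joinUpTo (w : ℕ → List Bool) : ℕ → List Bool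
  | 0 => []
  | 1 => w 1
  | (k + 2) => join2 (joinUpTo w (k + 1)) (w (k + 2))

/-- `r` is a sequence of `n+4` `n`-blocks preceded by a nonempty word in `∅^*` of
length at least `n+2`. -/
def BlockRefine (n : ℕ) (r : List Bool) : Prop :=
  ∃ (z : List Bool) (cs : List (List Bool)),
    r = z ++ cs.flatten ∧ z ≠ [] ∧ n + 2 ≤ z.length ∧ (∀ x ∈ z, x = false) ∧
    cs.length = n + 4 ∧ (∀ c ∈ cs, IsNBlock n c)

/-- `w'` is obtained from `j` by replacing the last symbol with `∅` and replacing
each `n`-block of `j` by a sequence of `n+4` `n`-blocks preceded by a nonempty word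
in `∅^*` of length at least `n+2`. -/
def SuccRel (n : ℕ) (j w' : List Bool) : Prop :=
  ∃ (bls rs : List (List Bool)),
    (∀ b ∈ bls, IsNBlock n b) ∧
    j = bls.flatten ++ [true] ∧
    w' = rs.flatten ++ [false] ∧
    bls.length = rs.length ∧
    ∀ pr ∈ List.zip bls rs, pr.2.length = pr.1.length ∧ BlockRefine n pr.2

/-- `⟨w_1, …, w_n⟩` satisfies the `n`-fractal requirement. -/
def FractalReq (n ℓ : ℕ) (w : ℕ → List Bool) : Prop :=
  (∀ k, 1 ≤ k → k ≤ n → (w k).length = ℓ) ∧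
  (∀ k, 1 ≤ k → k ≤ n → ∃ bls : List (List Bool),
      (∀ b ∈ bls, IsNBlock n b) ∧ joinUpTo w k = bls.flatten ++ [true]) ∧
  (∃ bls : List (List Bool),
      (∀ b ∈ bls, IsNBlock n b) ∧ joinUpTo w 1 = bls.flatten ++ [true] ∧
      bls.length = n + 4) ∧
  (∀ k, 1 ≤ k → k < n → SuccRel n (joinUpTo w k) (w (k + 1)))

/-- The defining conditions of the regular tree structure `K_n` (KLTL section),
over `AP = {p}` (modelled by `Unit`), with parameter `ℓ = ℓ_n > 1`. -/
structure KLTLKnData (n : ℕ) (T : TreeKripke Unit) (ℓ : ℕ) where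
  /-- the distinguished successor `η` of the root -/
  eta : List ℕ
  /-- the successors `ξ_1, …, ξ_n` of the root -/
  xi : ℕ → List ℕ
  /-- the words `w_0, …, w_n` of length `ℓ` -/
  w : ℕ → List Bool
  /-- the unique initial path visiting `η` -/
  pEta : ℕ → List ℕ
  /-- the unique initial paths visiting `ξ_1, …, ξ_n` -/
  pXi : ℕ → ℕ → List ℕ
  edge_eta : T.edge [] eta
  edge_xi : ∀ k, 1 ≤ k → k ≤ n → T.edge [] (xi k)
  succ_only : ∀ τ, T.edge [] τ → τ = eta ∨ ∃ k, 1 ≤ k ∧ k ≤ n ∧ τ = xi k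
  eta_ne_xi : ∀ k, 1 ≤ k → k ≤ n → eta ≠ xi k
  xi_inj : ∀ k k', 1 ≤ k → k ≤ n → 1 ≤ k' → k' ≤ n → xi k = xi k' → k = k'
  pEta_init : T.TInit pEta
  pEta_visits : ∃ i, pEta i = eta
  pEta_unique : ∀ pa, T.TInit pa → (∃ i, pa i = eta) → pa = pEta
  pXi_init : ∀ k, 1 ≤ k → k ≤ n → T.TInit (pXi k)
  pXi_visits : ∀ k, 1 ≤ k → k ≤ n → ∃ i, pXi k i = xi k
  pXi_unique : ∀ k, 1 ≤ k → k ≤ n → ∀ pa, T.TInit pa → (∃ i, pa i = xi k) → pa = pXi k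
  w0_len : (w 0).length = ℓ
  fractal : FractalReq n ℓ w
  /-- `w_0` is the dual of `join(w_1, …, w_n)` -/
  w0_dual : w 0 = (joinUpTo w n).map (fun b => !b)
  /-- the trace of `π(η)` is `∅·w_0·{p}^ω` -/
  trace_eta₀ : () ∉ T.V (pEta 0)
  trace_eta₁ : ∀ i, 1 ≤ i → i ≤ ℓ → (() ∈ T.V (pEta i) ↔ (w 0).getD (i - 1) false = true)
  trace_eta₂ : ∀ i, ℓ + 1 ≤ i → () ∈ T.V (pEta i)
  /-- the trace of `π(ξ_k)` is `∅·w_k·∅^ω` -/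
  trace_xi₀ : ∀ k, 1 ≤ k → k ≤ n → () ∉ T.V (pXi k 0)
  trace_xi₁ : ∀ k, 1 ≤ k → k ≤ n → ∀ i, 1 ≤ i → i ≤ ℓ →
      (() ∈ T.V (pXi k i) ↔ (w k).getD (i - 1) false = true)
  trace_xi₂ : ∀ k, 1 ≤ k → k ≤ n → ∀ i, ℓ + 1 ≤ i → () ∉ T.V (pXi k i)

/-- `ia = i_alert`: the third main position (in increasing order) at which `π(ξ_1)`
is labeled `{p}` in `K_n` (equivalently, at which `w_1` carries `true`). -/
def IsAlert (ℓ : ℕ) (w1 : List Bool) (ia : ℕ) : Prop :=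
  1 ≤ ia ∧ ia ≤ ℓ ∧ w1.getD (ia - 1) false = true ∧
  ((Finset.Icc 1 ℓ).filter (fun i => i < ia ∧ w1.getD (i - 1) false = true)).card = 2

/-- `M` is obtained from `K_n` by replacing the label `{p}` of `π(ξ_1)(i_alert)`
with `∅`. -/
def MObtainedKLTL {n ℓ : ℕ} {T : TreeKripke Unit} (M : TreeKripke Unit)
    (D : KLTLKnData n T ℓ) (ia : ℕ) : Prop :=
  M.nodes = T.nodes ∧ M.edge = T.edge ∧
    ∀ τ, M.V τ = if τ = D.pXi 1 ia then ∅ else T.V τ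
/-- `p ∈ w_k(i-1)`: the label of `π(ξ_k)` at main position `i` in `K_n`. -/
def LabW (w : ℕ → List Bool) (k i : ℕ) : Prop := (w k).getD (i - 1) false = true

/-- A main position: a position in `[1, ℓ]`. -/
def MainPos (ℓ i : ℕ) : Prop := 1 ≤ i ∧ i ≤ ℓ

/-- `i` is a main `p`-position of type `ξ_k` (in `K_n`). -/
def HasType (n ℓ : ℕ) (w : ℕ → List Bool) (i k : ℕ) : Prop :=
  MainPos ℓ i ∧ 1 ≤ k ∧ k ≤ n ∧ LabW w k i

/-- A main `p`-position. -/
def PPos (n ℓ : ℕ) (w : ℕ → List Bool) (i : ℕ) : Prop :=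
  ∃ k, HasType n ℓ w i k

/-- A main `∅`-position. -/
def ZPos (n ℓ : ℕ) (w : ℕ → List Bool) (i : ℕ) : Prop :=
  MainPos ℓ i ∧ ¬ PPos n ℓ w i

/-- `j = p(i)`: the least main `p`-position `≥ i`. -/
def PAfter (n ℓ : ℕ) (w : ℕ → List Bool) (i j : ℕ) : Prop :=
  PPos n ℓ w j ∧ i ≤ j ∧ ∀ j', PPos n ℓ w j' → i ≤ j' → j ≤ j'

/-- The `h*`-type of a main `p`-position: its type, except that for `h* ≠ 1` the
`h*`-type of `i_alert` is `ξ_{h*}`. -/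
def HType (n ℓ : ℕ) (w : ℕ → List Bool) (ia h i k : ℕ) : Prop :=
  (h ≠ 1 ∧ i = ia ∧ PPos n ℓ w i ∧ k = h) ∨
  (¬(h ≠ 1 ∧ i = ia) ∧ HasType n ℓ w i k)

/-- `[i, j]` is an `h*`-macro-block: `i < j` are main `p`-positions of the same
`h*`-type `ξ_k` and no main `p`-position strictly between them has `h*`-type
`⪯ ξ_k`. -/
def MacroBlock (n ℓ : ℕ) (w : ℕ → List Bool) (ia h i j : ℕ) : Prop :=
  i < j ∧ ∃ k, HType n ℓ w ia h i k ∧ HType n ℓ w ia h j k ∧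
    ∀ m r, i < m → m < j → HType n ℓ w ia h m r → k < r

/-- The `h*`-macro-block `[i, j]` has `h*`-order `m`: the maximal chain of
consecutive `h*`-successors starting at `[i, j]` has length `m`. -/
def BlockOrder (n ℓ : ℕ) (w : ℕ → List Bool) (ia h i j m : ℕ) : Prop :=
  1 ≤ m ∧ ∃ c : ℕ → ℕ, c 0 = i ∧ c 1 = j ∧
    (∀ t, t < m → MacroBlock n ℓ w ia h (c t) (c (t + 1))) ∧
    ¬ ∃ j', MacroBlock n ℓ w ia h (c m) j'

/-- The `h*`-order of a main `p`-position `i`: the `h*`-order of the `h*`-macro-block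
with first position `i`, or `0` if there is none. -/
def POrder (n ℓ : ℕ) (w : ℕ → List Bool) (ia h i m : ℕ) : Prop :=
  (m = 0 ∧ ¬ ∃ j, MacroBlock n ℓ w ia h i j) ∨
  ∃ j, BlockOrder n ℓ w ia h i j m

/-- `j` is the `h*`-low-ancestor of `i`: the least main `p`-position `> i` whose
`h*`-type is strictly below that of `i`. -/
def LowAnc (n ℓ : ℕ) (w : ℕ → List Bool) (ia h i j : ℕ) : Prop :=
  ∃ k, HType n ℓ w ia h i k ∧ i < j ∧ (∃ r, HType n ℓ w ia h j r ∧ r < k) ∧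
    ∀ j' r', i < j' → HType n ℓ w ia h j' r' → r' < k → j ≤ j'

/-- The `h*`-orders of `i` and `j` are equal or both exceed `m`. -/
def OrdCond (n ℓ : ℕ) (w : ℕ → List Bool) (ia h m i j : ℕ) : Prop :=
  ∃ oi oj, POrder n ℓ w ia h i oi ∧ POrder n ℓ w ia h j oj ∧
    (oi = oj ∨ (m < oi ∧ m < oj))

/-- `(h*, m)`-compatibility of main `p`-positions: same `h*`-type, orders equal or
both `> m`, and either the common `h*`-type is `ξ_1` or the `h*`-low-ancestors are
`(h*, m)`-compatible. -/
inductive PComp (n ℓ : ℕ) (w : ℕ → List Bool) (ia h m : ℕ) : ℕ → ℕ → Prop where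
  | base (i j : ℕ) : HType n ℓ w ia h i 1 → HType n ℓ w ia h j 1 →
      OrdCond n ℓ w ia h m i j → PComp n ℓ w ia h m i j
  | step (i j k ai aj : ℕ) : HType n ℓ w ia h i k → HType n ℓ w ia h j k →
      OrdCond n ℓ w ia h m i j →
      LowAnc n ℓ w ia h i ai → LowAnc n ℓ w ia h j aj →
      PComp n ℓ w ia h m ai aj → PComp n ℓ w ia h m i j

/-- The relation `R(h*, m)` on main positions. -/
def RPos (n ℓ : ℕ) (w : ℕ → List Bool) (ia h m i j : ℕ) : Prop :=
  (PPos n ℓ w i ∧ PPos n ℓ w j ∧ PComp n ℓ w ia h m i j) ∨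
  (ZPos n ℓ w i ∧ ZPos n ℓ w j ∧
    ∃ pi pj, PAfter n ℓ w i pi ∧ PAfter n ℓ w j pj ∧ PComp n ℓ w ia h m pi pj ∧
      (pi - i = pj - j ∨ (m < pi - i ∧ m < pj - j)))
/-- The `m`-round Ehrenfeucht–Fraïssé equivalence of ω-words for linear temporal logic
with next and until. -/
def LTLEquiv : ℕ → Stream' ℕ → Stream' ℕ → Prop
  | 0, α, β => α.head = β.head
  | m + 1, α, β => α.head = β.head ∧ LTLEquiv m α.tail β.tail ∧
      (∀ j, ∃ j', LTLEquiv m (α.drop j) (β.drop j') ∧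
        ∀ k' < j', ∃ k < j, LTLEquiv m (α.drop k) (β.drop k')) ∧
      (∀ j', ∃ j, LTLEquiv m (α.drop j) (β.drop j') ∧
        ∀ k < j, ∃ k' < j', LTLEquiv m (α.drop k) (β.drop k'))

namespace LTLEquiv

theorem refl : ∀ (m : ℕ) (α : Stream' ℕ), LTLEquiv m α α
  | 0, _ => rfl
  | m + 1, _ => ⟨rfl, refl m _, fun j => ⟨j, refl m _, fun k hk => ⟨k, hk, refl m _⟩⟩,
      fun j => ⟨j, refl m _, fun k hk => ⟨k, hk, refl m _⟩⟩⟩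

theorem symm : ∀ {m : ℕ} {α β : Stream' ℕ}, LTLEquiv m α β → LTLEquiv m β α
  | 0, _, _, h => Eq.symm h
  | m + 1, _, _, ⟨h0, h1, h2, h3⟩ => by
    refine ⟨h0.symm, h1.symm, fun j => ?_, fun j => ?_⟩
    · obtain ⟨j', hj, hk⟩ := h3 j
      refine ⟨j', hj.symm, fun k hk' => ?_⟩
      obtain ⟨k', hk1, hk2⟩ := hk k hk'
      exact ⟨k', hk1, hk2.symm⟩
    · obtain ⟨j', hj, hk⟩ := h2 j
      refine ⟨j', hj.symm, fun k hk' => ?_⟩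
      obtain ⟨k', hk1, hk2⟩ := hk k hk'
      exact ⟨k', hk1, hk2.symm⟩

theorem trans : ∀ {m : ℕ} {α β γ : Stream' ℕ},
    LTLEquiv m α β → LTLEquiv m β γ → LTLEquiv m α γ
  | 0, _, _, _, h, h' => Eq.trans h h'
  | m + 1, _, _, _, ⟨h0, h1, h2, h3⟩, ⟨g0, g1, g2, g3⟩ => by
    refine ⟨h0.trans g0, h1.trans g1, fun j => ?_, fun j => ?_⟩
    · obtain ⟨j', hj, hk⟩ := h2 j
      obtain ⟨j'', hj', hk'⟩ := g2 j'
      refine ⟨j'', hj.trans hj', fun k hkj => ?_⟩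
      obtain ⟨k', hk1, hk2⟩ := hk' k hkj
      obtain ⟨k'', hk3, hk4⟩ := hk k' hk1
      exact ⟨k'', hk3, hk4.trans hk2⟩
    · obtain ⟨j', hj, hk⟩ := g3 j
      obtain ⟨j'', hj', hk'⟩ := h3 j'
      refine ⟨j'', hj'.trans hj, fun k hkj => ?_⟩
      obtain ⟨k', hk1, hk2⟩ := hk' k hkj
      obtain ⟨k'', hk3, hk4⟩ := hk k' hk1
      exact ⟨k'', hk3, hk2.trans hk4⟩

theorem of_succ : ∀ {m : ℕ} {α β : Stream' ℕ}, LTLEquiv (m + 1) α β → LTLEquiv m α β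
  | 0, _, _, h => h.1
  | m + 1, _, _, ⟨h0, h1, h2, h3⟩ => by
    refine ⟨h0, h1.of_succ, fun j => ?_, fun j => ?_⟩
    · obtain ⟨j', hj, hk⟩ := h2 j
      refine ⟨j', hj.of_succ, fun k hk' => ?_⟩
      obtain ⟨k', hk1, hk2⟩ := hk k hk'
      exact ⟨k', hk1, hk2.of_succ⟩
    · obtain ⟨j', hj, hk⟩ := h3 j
      refine ⟨j', hj.of_succ, fun k hk' => ?_⟩
      obtain ⟨k', hk1, hk2⟩ := hk k hk'
      exact ⟨k', hk1, hk2.of_succ⟩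

theorem mono {m m' : ℕ} {α β : Stream' ℕ} (h : LTLEquiv m α β) (hm : m' ≤ m) :
    LTLEquiv m' α β := by
  induction hm with
  | refl => exact h
  | step _ ih => exact ih h.of_succ

theorem head_eq {m : ℕ} {α β : Stream' ℕ} (h : LTLEquiv m α β) : α.head = β.head :=
  h.mono (Nat.zero_le m)

theorem cons (a : ℕ) : ∀ {m : ℕ} {α β : Stream' ℕ}, LTLEquiv m α β →
    LTLEquiv m (Stream'.cons a α) (Stream'.cons a β)
  | 0, _, _, _ => rfl
  | m + 1, α, β, h => by
    have h' := h.of_succ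
    obtain ⟨-, -, h2, h3⟩ := h
    refine ⟨rfl, h', fun j => ?_, fun j => ?_⟩
    · rcases j with _ | j
      · exact ⟨0, cons a h', fun k hk => absurd hk (Nat.not_lt_zero k)⟩
      · obtain ⟨j', hj, hk⟩ := h2 j
        refine ⟨j' + 1, hj, fun k hkj => ?_⟩
        rcases k with _ | k
        · exact ⟨0, Nat.succ_pos j, cons a h'⟩
        · obtain ⟨k', hk1, hk2⟩ := hk k (Nat.lt_of_succ_lt_succ hkj)
          exact ⟨k' + 1, Nat.succ_lt_succ hk1, hk2⟩
    · rcases j with _ | j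
      · exact ⟨0, cons a h', fun k hk => absurd hk (Nat.not_lt_zero k)⟩
      · obtain ⟨j', hj, hk⟩ := h3 j
        refine ⟨j' + 1, hj, fun k hkj => ?_⟩
        rcases k with _ | k
        · exact ⟨0, Nat.succ_pos j, cons a h'⟩
        · obtain ⟨k', hk1, hk2⟩ := hk k (Nat.lt_of_succ_lt_succ hkj)
          exact ⟨k' + 1, Nat.succ_lt_succ hk1, hk2⟩

theorem append (u : List ℕ) {m : ℕ} {α β : Stream' ℕ} (h : LTLEquiv m α β) :
    LTLEquiv m (u ++ₛ α) (u ++ₛ β) := by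
  induction u with
  | nil => exact h
  | cons a u ih => exact ih.cons a

end LTLEquiv

/-- Dropping part of a finite prefix of a stream. -/
theorem drop_appendStream_of_le (u : List ℕ) (α : Stream' ℕ) :
    ∀ {j : ℕ}, j ≤ u.length → (u ++ₛ α).drop j = u.drop j ++ₛ α := by
  induction u with
  | nil => intro j hj; obtain rfl : j = 0 := by simpa using hj
           rfl
  | cons a u ih =>
    intro j hj
    rcases j with _ | j
    · rfl
    · exact ih (Nat.le_of_succ_le_succ hj)

theorem drop_appendStream_add (u : List ℕ) (α : Stream' ℕ) (j : ℕ) :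
    (u ++ₛ α).drop (u.length + j) = α.drop j := by
  rw [← Stream'.drop_drop, Stream'.drop_append_stream]

/-- Words that are interchangeable as factors of ω-words, up to `m` rounds. -/
def WordEquiv (m : ℕ) (u v : List ℕ) : Prop :=
  ∀ α : Stream' ℕ, LTLEquiv m (u ++ₛ α) (v ++ₛ α)

namespace WordEquiv

theorem refl (m : ℕ) (u : List ℕ) : WordEquiv m u u := fun _ => .refl m _

theorem symm {m : ℕ} {u v : List ℕ} (h : WordEquiv m u v) : WordEquiv m v u :=
  fun α => (h α).symm

theorem trans {m : ℕ} {u v x : List ℕ} (h : WordEquiv m u v) (h' : WordEquiv m v x) :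
    WordEquiv m u x := fun α => (h α).trans (h' α)

theorem append {m : ℕ} {u v u' v' : List ℕ} (h : WordEquiv m u v) (h' : WordEquiv m u' v') :
    WordEquiv m (u ++ u') (v ++ v') := fun α => by
  rw [Stream'.append_append_stream, Stream'.append_append_stream]
  exact (h _).trans ((h' α).append v)

theorem cons {m : ℕ} {u v : List ℕ} (a : ℕ) (h : WordEquiv m u v) :
    WordEquiv m (a :: u) (a :: v) := (refl m [a]).append h

/-- One more repetition of `u` is not noticeable once there are more than `m`. -/
theorem power_succ {u : List ℕ} (hu : u ≠ []) : ∀ {m a : ℕ}, m + 1 ≤ a →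
    WordEquiv m (List.replicate a u).flatten (List.replicate (a + 1) u).flatten
  | m, a + 1, ha, α => by
    have hpos : 0 < u.length := List.length_pos_of_ne_nil hu
    rw [List.replicate_succ (n := a + 1), List.replicate_succ, List.flatten_cons,
      List.flatten_cons, Stream'.append_append_stream, Stream'.append_append_stream]
    set β := (List.replicate a u).flatten ++ₛ α with hβ
    set γ := (List.replicate (a + 1) u).flatten ++ₛ α with hγ
    have hγβ : γ = u ++ₛ β := by
      rw [hγ, hβ, List.replicate_succ, List.flatten_cons, Stream'.append_append_stream]
    have hdrop : ∀ j, (u ++ₛ γ).drop (u.length + j) = (u ++ₛ β).drop j := fun j => by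
      rw [drop_appendStream_add, hγβ]
    rcases m with _ | m
    · obtain ⟨c, v, rfl⟩ := List.exists_cons_of_ne_nil hu
      rfl
    · have ih : LTLEquiv m β γ := power_succ hu (by omega) α
      have hin : ∀ j ≤ u.length, LTLEquiv m ((u ++ₛ β).drop j) ((u ++ₛ γ).drop j) := by
        intro j hj
        rw [drop_appendStream_of_le u _ hj, drop_appendStream_of_le u _ hj]
        exact ih.append _
      refine ⟨?_, hin 1 hpos, fun j => ?_, fun j => ?_⟩
      · obtain ⟨c, v, rfl⟩ := List.exists_cons_of_ne_nil hu
        rfl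
      · rcases lt_or_ge j u.length with hj | hj
        · exact ⟨j, hin j hj.le, fun k hk => ⟨k, hk, hin k (hk.trans hj).le⟩⟩
        · refine ⟨u.length + j, hdrop j ▸ .refl m _, fun k hk => ?_⟩
          rcases lt_or_ge k u.length with hk' | hk'
          · exact ⟨k, hk'.trans_le hj, hin k hk'.le⟩
          · obtain ⟨k, rfl⟩ := Nat.exists_eq_add_of_le hk'
            exact ⟨k, by omega, hdrop k ▸ .refl m _⟩
      · rcases lt_or_ge j u.length with hj | hj
        · exact ⟨j, hin j hj.le, fun k hk => ⟨k, hk, hin k (hk.trans hj).le⟩⟩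
        · obtain ⟨j, rfl⟩ := Nat.exists_eq_add_of_le hj
          exact ⟨j, hdrop j ▸ .refl m _, fun k hk =>
            ⟨u.length + k, by omega, hdrop k ▸ .refl m _⟩⟩

theorem power_le {u : List ℕ} (hu : u ≠ []) {m a b : ℕ} (ha : m + 1 ≤ a) (hab : a ≤ b) :
    WordEquiv m (List.replicate a u).flatten (List.replicate b u).flatten := by
  induction hab with
  | refl => exact refl _ _
  | step h ih => exact ih.trans (power_succ hu (ha.trans h))

/-- Sufficiently high powers of a word are interchangeable. -/
theorem power {u : List ℕ} (hu : u ≠ []) {m a b : ℕ} (ha : m + 1 ≤ a) (hb : m + 1 ≤ b) :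
    WordEquiv m (List.replicate a u).flatten (List.replicate b u).flatten :=
  (le_total a b).elim (power_le hu ha) fun h => (power_le hu hb h).symm

theorem replicate {m a b : ℕ} (c : ℕ) (ha : m + 1 ≤ a) (hb : m + 1 ≤ b) :
    WordEquiv m (List.replicate a c) (List.replicate b c) := by
  have h : ∀ a, (List.replicate a [c]).flatten = List.replicate a c := fun a => by
    induction a with
    | zero => rfl
    | succ a ih => rw [List.replicate_succ, List.flatten_cons, ih]; rfl
  simpa only [h] using power (List.cons_ne_nil c []) ha hb

end WordEquiv

/-- The skeleton of the refinement to depth `d` of a gap at level `k`: `N` letters `k + 1`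
are inserted, and the `N + 1` resulting gaps are refined in the same way. -/
def gapSkeleton (N : ℕ) : ℕ → ℕ → List ℕ
  | _, 0 => []
  | k, d + 1 => gapSkeleton N (k + 1) d ++
      (List.replicate N ((k + 1) :: gapSkeleton N (k + 1) d)).flatten

theorem lt_of_mem_gapSkeleton {N : ℕ} : ∀ {d k a : ℕ}, a ∈ gapSkeleton N k d → k < a
  | 0, _, _, h => absurd h List.not_mem_nil
  | d + 1, k, a, h => by
    rw [gapSkeleton, List.mem_append, List.mem_flatten] at h
    rcases h with h | ⟨v, hv, h⟩
    · exact (Nat.lt_succ_self k).trans (lt_of_mem_gapSkeleton h)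
    · rw [List.eq_of_mem_replicate hv, List.mem_cons] at h
      rcases h with rfl | h
      · exact Nat.lt_succ_self k
      · exact (Nat.lt_succ_self k).trans (lt_of_mem_gapSkeleton h)

/-- The word with letters `s`, each followed by `g` zeros. -/
def spaced (g : ℕ) (s : List ℕ) : List ℕ := s.flatMap fun a => a :: List.replicate g 0

/-- A refined gap in which all innermost gaps are words `0 ^ g`. -/
def gapWord (g N k d : ℕ) : List ℕ := List.replicate g 0 ++ spaced g (gapSkeleton N k d)

theorem spaced_append (g : ℕ) (s t : List ℕ) : spaced g (s ++ t) = spaced g s ++ spaced g t :=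
  List.flatMap_append

theorem spaced_cons_gapSkeleton (g N k d a : ℕ) :
    spaced g (a :: gapSkeleton N k d) = a :: gapWord g N k d := rfl

theorem spaced_flatten_replicate (g : ℕ) (s : List ℕ) (a : ℕ) :
    spaced g (List.replicate a s).flatten = (List.replicate a (spaced g s)).flatten := by
  induction a with
  | zero => rfl
  | succ a ih =>
    rw [List.replicate_succ, List.flatten_cons, spaced_append, ih, List.replicate_succ,
      List.flatten_cons]

theorem gapWord_succ (g N k d : ℕ) : gapWord g N k (d + 1) =
    gapWord g N (k + 1) d ++ (List.replicate N ((k + 1) :: gapWord g N (k + 1) d)).flatten := by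
  rw [gapWord, gapSkeleton, spaced_append, spaced_flatten_replicate, spaced_cons_gapSkeleton,
    ← List.append_assoc]
  rfl

/-- A letter of a finer level inside a gap is absorbed. -/
theorem gapWord_absorb {m g N h : ℕ} (hN : m + 1 ≤ N) : ∀ {d k : ℕ}, k < h → h ≤ k + d →
    WordEquiv m (gapWord g N k d ++ h :: gapWord g N k d) (gapWord g N k d)
  | 0, _, h1, h2 => absurd h2 (by omega)
  | d + 1, k, h1, h2 => by
    obtain ⟨N, rfl⟩ := Nat.exists_eq_add_of_le' hN
    rw [gapWord_succ]
    set X := gapWord g (N + (m + 1)) (k + 1) d with hX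
    set u := (k + 1) :: X with hu
    have hne : u ≠ [] := List.cons_ne_nil _ _
    set p : ℕ → List ℕ := fun a => (List.replicate a u).flatten with hp
    have hadd : ∀ a b, p a ++ p b = p (a + b) := fun a b => by
      simp only [hp, List.replicate_add, List.flatten_append]
    have hone : p 1 = u := by simp [hp]
    change WordEquiv m ((X ++ p (N + (m + 1))) ++ h :: (X ++ p (N + (m + 1))))
      (X ++ p (N + (m + 1)))
    rcases Nat.eq_or_lt_of_le (Nat.succ_le_of_lt h1) with rfl | hlt
    · have : (X ++ p (N + (m + 1))) ++ k.succ :: (X ++ p (N + (m + 1))) =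
          X ++ p (N + (m + 1) + (1 + (N + (m + 1)))) := by
        rw [← hadd (N + (m + 1)), ← hadd 1, hone]; simp [hu]
      rw [this]
      exact (WordEquiv.refl m X).append (WordEquiv.power hne (by omega) (by omega))
    · have ih : WordEquiv m (X ++ h :: X) X := gapWord_absorb hN hlt (by omega)
      have e1 : (X ++ p (N + (m + 1))) ++ h :: (X ++ p (N + (m + 1))) =
          X ++ (p (N + m) ++ ((k + 1) :: (X ++ h :: X) ++ p (N + (m + 1)))) := by
        rw [← add_assoc N m 1, ← hadd (N + m) 1, hone]; simp [hu]
      have e2 : p (N + m) ++ ((k + 1) :: X ++ p (N + (m + 1))) =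
          p (N + m + (1 + (N + (m + 1)))) := by
        rw [← hadd (N + m), ← hadd 1, hone]
      rw [e1]
      refine (WordEquiv.refl m X).append (((WordEquiv.refl m _).append
        ((ih.cons (k + 1)).append (WordEquiv.refl m _))).trans ?_)
      rw [e2]
      exact WordEquiv.power hne (by omega) (by omega)

/-- Overwrite a letter by `k` where the Boolean is set. -/
def overwrite (k a : ℕ) (b : Bool) : ℕ := if b then k else a

/-- The word recording at each position the least level `j ≤ k` whose word `w j` is set
there, and `0` if there is none (for words with pairwise disjoint supports). -/
def letters (ℓ : ℕ) (w : ℕ → List Bool) : ℕ → List ℕ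
  | 0 => List.replicate ℓ 0
  | k + 1 => List.zipWith (overwrite (k + 1)) (letters ℓ w k) (w (k + 1))

/-- The nonzero letters of a word. -/
def skeleton (u : List ℕ) : List ℕ := u.filter (· != 0)

theorem skeleton_append (u v : List ℕ) : skeleton (u ++ v) = skeleton u ++ skeleton v :=
  List.filter_append ..

/-- The skeleton of the word of level `j + 1`, without its last letter. -/
def levelSkeleton (N : ℕ) : ℕ → List ℕ
  | 0 => List.replicate N 1
  | j + 1 => (levelSkeleton N j).flatMap fun a => a :: List.replicate N (j + 2)

theorem flatMap_replicate_eq_flatten (N a : ℕ) (f : ℕ → List ℕ) :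
    (List.replicate N a).flatMap f = (List.replicate N (f a)).flatten := by
  rw [List.flatMap, List.map_replicate]

theorem levelSkeleton_add (N : ℕ) : ∀ d j : ℕ, levelSkeleton N (j + d) =
    (levelSkeleton N j).flatMap fun a => a :: gapSkeleton N (j + 1) d
  | 0, j => by simp [gapSkeleton]
  | d + 1, j => by
    rw [show j + (d + 1) = j + 1 + d by omega, levelSkeleton_add N d (j + 1), levelSkeleton,
      List.flatMap_assoc]
    refine List.flatMap_congr fun a _ => ?_
    rw [List.flatMap_cons, flatMap_replicate_eq_flatten, gapSkeleton, List.cons_append]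

theorem length_letters {n ℓ : ℕ} {w : ℕ → List Bool} (hw : FractalReq n ℓ w) :
    ∀ {k : ℕ}, k ≤ n → (letters ℓ w k).length = ℓ
  | 0, _ => List.length_replicate
  | k + 1, hk => by
    rw [letters, List.length_zipWith, length_letters hw (by omega), hw.1 _ (by omega) hk,
      min_self]

theorem map_ne_zero_overwrite (k : ℕ) : ∀ (u : List ℕ) (r : List Bool),
    (List.zipWith (overwrite (k + 1)) u r).map (· != 0) = join2 (u.map (· != 0)) r
  | [], r => by simp [join2]
  | a :: u, [] => by simp [join2]
  | a :: u, b :: r => by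
    have ih := map_ne_zero_overwrite k u r
    simp only [join2] at ih
    cases b <;> simp [join2, overwrite, ih]

theorem join2_replicate_false : ∀ (r : List Bool),
    join2 (List.replicate r.length false) r = r
  | [] => rfl
  | b :: r => by
    have ih := join2_replicate_false r
    simp only [join2] at ih ⊢
    rw [List.length_cons, List.replicate_succ, List.zipWith_cons_cons, ih, Bool.false_or]

theorem joinUpTo_eq_map_letters {n ℓ : ℕ} {w : ℕ → List Bool} (hw : FractalReq n ℓ w) :
    ∀ {k : ℕ}, k + 1 ≤ n →
      joinUpTo w (k + 1) = (letters ℓ w (k + 1)).map (· != 0)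
  | 0, hk => by
    have := join2_replicate_false (w 1)
    rw [letters, map_ne_zero_overwrite, letters, joinUpTo, List.map_replicate,
      ← hw.1 1 le_rfl hk]
    exact this.symm
  | k + 1, hk => by
    rw [letters, map_ne_zero_overwrite, joinUpTo, joinUpTo_eq_map_letters hw (by omega)]

theorem skeleton_overwrite_zero (k : ℕ) : ∀ r : List Bool,
    skeleton (List.zipWith (overwrite (k + 1)) (List.replicate r.length 0) r) =
      List.replicate (r.count true) (k + 1)
  | [] => rfl
  | b :: r => by
    have ih := skeleton_overwrite_zero k r
    simp only [skeleton] at ih ⊢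
    cases b
    · simp [List.replicate_succ, overwrite, ih]
    · simp [List.replicate_succ, overwrite, ih]

theorem IsNBlock.count_true {n : ℕ} {b : List Bool} (h : IsNBlock n b) : b.count true = 1 := by
  rw [h.2]; simp [List.count_replicate]

theorem count_true_flatten_blocks {n : ℕ} : ∀ {cs : List (List Bool)},
    (∀ c ∈ cs, IsNBlock n c) → cs.flatten.count true = cs.length
  | [], _ => rfl
  | c :: cs, h => by
    rw [List.flatten_cons, List.count_append, (h c List.mem_cons_self).count_true,
      count_true_flatten_blocks fun c hc => h c (List.mem_cons_of_mem _ hc), List.length_cons,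
      add_comm]

theorem BlockRefine.eq_false_cons {n : ℕ} {r : List Bool} (h : BlockRefine n r) :
    ∃ r', r = false :: r' ∧ r'.count true = n + 4 := by
  obtain ⟨z, cs, rfl, hz, -, hf, hl, hc⟩ := h
  obtain ⟨a, z, rfl⟩ := List.exists_cons_of_ne_nil hz
  obtain rfl := hf a List.mem_cons_self
  refine ⟨z ++ cs.flatten, rfl, ?_⟩
  rw [List.count_append, count_true_flatten_blocks hc, hl, List.count_eq_zero_of_not_mem, zero_add]
  intro ht
  simpa using hf true (List.mem_cons_of_mem _ ht)

theorem eq_cons_zeros_of_map_eq_block {n : ℕ} {x : List ℕ} (h : IsNBlock n (x.map (· != 0))) :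
    ∃ a g, a ≠ 0 ∧ n + 1 ≤ g ∧ x = a :: List.replicate g 0 := by
  obtain ⟨hl, he⟩ := h
  rcases x with _ | ⟨a, x⟩
  · simp at hl
  · rw [List.length_map, List.length_cons] at hl
    rw [List.map_cons, List.cons.injEq] at he
    refine ⟨a, x.length, by simpa using he.1, by omega, ?_⟩
    rw [List.cons.injEq]
    refine ⟨rfl, List.eq_replicate_iff.2 ⟨rfl, fun c hc => ?_⟩⟩
    have hm : (c != 0) ∈ x.map (· != 0) := List.mem_map_of_mem hc
    rw [he.2] at hm
    simpa using List.eq_of_mem_replicate hm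

/-- Refining every block of a word inserts `n + 4` new letters after every letter, and never
overwrites a letter. -/
theorem overwrite_blocks {n : ℕ} (k : ℕ) : ∀ {bls rs : List (List Bool)} {u : List ℕ},
    (∀ b ∈ bls, IsNBlock n b) → bls.length = rs.length →
    (∀ pr ∈ List.zip bls rs, pr.2.length = pr.1.length ∧ BlockRefine n pr.2) →
    u.map (· != 0) = bls.flatten →
    u.length = rs.flatten.length ∧
    skeleton (List.zipWith (overwrite (k + 1)) u rs.flatten) =
      (skeleton u).flatMap (fun a => a :: List.replicate (n + 4) (k + 1)) ∧
    ∀ p ∈ List.zip u rs.flatten, p.2 = true → p.1 = 0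
  | [], rs, u, _, hl, _, hu => by
    obtain rfl : rs = [] := List.length_eq_zero_iff.1 hl.symm
    obtain rfl : u = [] := by simpa using hu
    simp [skeleton]
  | b :: bls, [], u, _, hl, _, _ => by simp at hl
  | b :: bls, r :: rs, u, hb, hl, hr, hu => by
    rw [List.flatten_cons, List.map_eq_append_iff] at hu
    obtain ⟨x, y, rfl, rfl, hy⟩ := hu
    obtain ⟨ihl, ihs, ihd⟩ := overwrite_blocks k
      (fun b hb' => hb b (List.mem_cons_of_mem _ hb')) (by simpa using hl)
      (fun pr hpr => hr pr (List.mem_cons_of_mem _ hpr)) hy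
    obtain ⟨hrl, hrr⟩ := hr (_, r) List.mem_cons_self
    obtain ⟨a, g, ha, -, rfl⟩ := eq_cons_zeros_of_map_eq_block (hb _ List.mem_cons_self)
    obtain ⟨r, rfl, hc⟩ := hrr.eq_false_cons
    obtain rfl : r.length = g := by simpa using hrl
    have hlen : (a :: List.replicate r.length 0).length = (false :: r).length := by simp
    refine ⟨by simp [ihl], ?_, ?_⟩
    · rw [List.flatten_cons, List.zipWith_append hlen, skeleton_append, ihs, skeleton_append,
        List.flatMap_append]
      congr 1
      have h0 := skeleton_overwrite_zero k r
      rw [hc] at h0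
      simp only [skeleton] at h0 ⊢
      simp [overwrite, ha, h0]
    · intro p hp
      rw [List.flatten_cons, List.zip_append hlen, List.mem_append, List.zip_cons_cons,
        List.mem_cons] at hp
      rcases hp with (rfl | hp) | hp
      · simp
      · intro _
        exact List.eq_of_mem_replicate (List.of_mem_zip hp).1
      · exact ihd p hp

theorem letters_succ {n ℓ : ℕ} {w : ℕ → List Bool} (hw : FractalReq n ℓ w) {k : ℕ}
    (h1 : 1 ≤ k) (hk : k < n) {s : List ℕ} (hs : skeleton (letters ℓ w k) = s ++ [1]) :
    skeleton (letters ℓ w (k + 1)) =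
        s.flatMap (fun a => a :: List.replicate (n + 4) (k + 1)) ++ [1] ∧
      ∀ p ∈ List.zip (letters ℓ w k) (w (k + 1)), p.2 = true → p.1 = 0 := by
  obtain ⟨bls, rs, hb, hj, hw', hl, hr⟩ := hw.2.2.2 k h1 hk
  obtain ⟨k, rfl⟩ := Nat.exists_eq_add_of_le' h1
  rw [joinUpTo_eq_map_letters hw hk.le, List.map_eq_append_iff] at hj
  obtain ⟨u, c, hu, hub, hc⟩ := hj
  obtain ⟨a, rfl, ha⟩ := List.map_eq_singleton_iff.1 hc
  obtain ⟨ihl, ihs, ihd⟩ := overwrite_blocks (k + 1) hb hl hr hub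
  have ha' : skeleton [a] = [a] := by simp [skeleton, ha]
  rw [hu, skeleton_append, ha'] at hs
  obtain ⟨rfl, rfl⟩ : skeleton u = s ∧ a = 1 := by
    simpa using List.append_inj' hs rfl
  rw [letters, hu, hw', List.zipWith_append ihl, skeleton_append, ihs, List.zip_append ihl]
  refine ⟨rfl, fun p hp hp2 => ?_⟩
  rcases List.mem_append.1 hp with hp | hp
  · exact ihd p hp hp2
  · obtain rfl : p = (1, false) := by simpa using hp
    simp at hp2

theorem skeleton_letters {n ℓ : ℕ} {w : ℕ → List Bool} (hw : FractalReq n ℓ w) :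
    ∀ {j : ℕ}, j + 1 ≤ n →
      skeleton (letters ℓ w (j + 1)) = levelSkeleton (n + 4) j ++ [1]
  | 0, hj => by
    obtain ⟨bls, hb, h1, hl⟩ := hw.2.2.1
    have h0 := skeleton_overwrite_zero 0 (w 1)
    rw [hw.1 1 le_rfl hj] at h0
    rw [letters, letters, h0, levelSkeleton]
    rw [joinUpTo] at h1
    rw [h1, List.count_append, count_true_flatten_blocks hb, hl]
    exact List.replicate_succ'
  | j + 1, hj => (letters_succ hw (by omega) hj (skeleton_letters hw (by omega))).1

theorem letters_eq_zero_of_word {n ℓ : ℕ} {w : ℕ → List Bool} (hw : FractalReq n ℓ w)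
    {k i : ℕ} (hk : k + 1 ≤ n) (hi : (w (k + 1)).getD i false = true) :
    (letters ℓ w k).getD i 0 = 0 := by
  rcases k with _ | k
  · rw [letters, List.getD_eq_getElem?_getD, List.getElem?_replicate]
    split <;> rfl
  · by_contra hne
    have hl : i < (letters ℓ w (k + 1)).length := by
      by_contra h
      exact hne (List.getD_eq_default _ _ (not_lt.1 h))
    have hl' : i < (w (k + 1 + 1)).length := by
      rw [hw.1 _ (by omega) hk]; rwa [length_letters hw (by omega)] at hl
    rw [List.getD_eq_getElem _ _ hl] at hne
    rw [List.getD_eq_getElem _ _ hl'] at hi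
    exact hne ((letters_succ hw (by omega) hk (skeleton_letters hw (by omega))).2
      ((letters ℓ w (k + 1))[i], (w (k + 1 + 1))[i])
      (List.mem_iff_getElem.2 ⟨i, by simp; omega, by simp⟩) hi)

theorem letters_succ_getD {n ℓ : ℕ} {w : ℕ → List Bool} (hw : FractalReq n ℓ w)
    {k : ℕ} (hk : k + 1 ≤ n) (i : ℕ) : (letters ℓ w (k + 1)).getD i 0 =
      overwrite (k + 1) ((letters ℓ w k).getD i 0) ((w (k + 1)).getD i false) := by
  have hl := length_letters hw (k := k) (by omega)
  have hl1 := length_letters hw hk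
  have hwl := hw.1 (k + 1) (by omega) hk
  rcases lt_or_ge i ℓ with h | h
  · rw [List.getD_eq_getElem _ _ (by omega), List.getD_eq_getElem _ _ (by omega),
      List.getD_eq_getElem _ _ (by omega)]
    simp [letters]
  · rw [List.getD_eq_default _ _ (by omega), List.getD_eq_default _ _ (by omega),
      List.getD_eq_default _ _ (by omega)]
    rfl

/-- The letter `j` occurs exactly at the positions where `w j` is set. -/
theorem letters_getD_eq_iff {n ℓ : ℕ} {w : ℕ → List Bool} (hw : FractalReq n ℓ w) (i : ℕ)
    {j : ℕ} (hj : 1 ≤ j) : ∀ {k : ℕ}, k ≤ n →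
      ((letters ℓ w k).getD i 0 = j ↔ j ≤ k ∧ (w j).getD i false = true)
  | 0, _ => by
    rw [letters, List.getD_eq_getElem?_getD, List.getElem?_replicate]
    split <;> simp <;> omega
  | k + 1, hk => by
    have ih := letters_getD_eq_iff hw i hj (k := k) (by omega)
    have hz := letters_eq_zero_of_word hw (i := i) hk
    rw [letters_succ_getD hw hk, overwrite]
    split
    · rename_i h
      rw [hz h] at ih
      constructor
      · rintro rfl
        exact ⟨le_rfl, h⟩
      · rintro ⟨h1, h2⟩
        rcases Nat.eq_or_lt_of_le h1 with h1 | h1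
        · exact h1.symm
        · exact absurd (ih.2 ⟨by omega, h2⟩) (by omega)
    · rename_i h
      rw [ih]
      constructor
      · rintro ⟨h1, h2⟩
        exact ⟨by omega, h2⟩
      · rintro ⟨h1, h2⟩
        rcases Nat.eq_or_lt_of_le h1 with rfl | h1
        · exact absurd h2 h
        · exact ⟨by omega, h2⟩

/-- The concatenation of the blocks `a 0^g` over the pairs `(a, g)` of a list. -/
def blockWord (P : List (ℕ × ℕ)) : List ℕ := P.flatMap fun p => p.1 :: List.replicate p.2 0

theorem blockWord_append (P Q : List (ℕ × ℕ)) :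
    blockWord (P ++ Q) = blockWord P ++ blockWord Q := List.flatMap_append

theorem exists_blockWord {n : ℕ} : ∀ {bls : List (List Bool)} {u : List ℕ},
    (∀ b ∈ bls, IsNBlock n b) → u.map (· != 0) = bls.flatten →
    ∃ P : List (ℕ × ℕ), u = blockWord P ∧ P.map Prod.fst = skeleton u ∧
      ∀ p ∈ P, n + 1 ≤ p.2
  | [], u, _, hu => by
    obtain rfl : u = [] := by simpa using hu
    exact ⟨[], rfl, rfl, by simp⟩
  | b :: bls, u, hb, hu => by
    rw [List.flatten_cons, List.map_eq_append_iff] at hu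
    obtain ⟨x, y, rfl, rfl, hy⟩ := hu
    obtain ⟨P, rfl, hP, hg⟩ := exists_blockWord
      (fun b hb' => hb b (List.mem_cons_of_mem _ hb')) hy
    obtain ⟨a, g, ha, hag, rfl⟩ := eq_cons_zeros_of_map_eq_block (hb _ List.mem_cons_self)
    refine ⟨(a, g) :: P, rfl, ?_, ?_⟩
    · rw [skeleton_append, List.map_cons, hP]
      simp [skeleton, ha]
    · intro p hp
      rcases List.mem_cons.1 hp with rfl | hp
      · exact hag
      · exact hg p hp

theorem blockWord_equiv_spaced {m g : ℕ} (hm : m + 1 ≤ g) : ∀ {P : List (ℕ × ℕ)},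
    (∀ p ∈ P, g ≤ p.2) → WordEquiv m (blockWord P) (spaced g (P.map Prod.fst))
  | [], _ => .refl m _
  | p :: P, h => by
    refine WordEquiv.append (u := p.1 :: List.replicate p.2 0)
      (v := p.1 :: List.replicate g 0) ?_
      (blockWord_equiv_spaced hm fun q hq => h q (List.mem_cons_of_mem _ hq))
    exact (WordEquiv.replicate 0 (hm.trans (h p List.mem_cons_self)) hm).cons _

theorem count_blockWord {a : ℕ} (ha : a ≠ 0) : ∀ P : List (ℕ × ℕ),
    (blockWord P).count a = (P.map Prod.fst).count a
  | [] => rfl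
  | p :: P => by
    have := count_blockWord ha P
    simp only [blockWord] at this
    rw [blockWord, List.flatMap_cons, List.count_append, this, List.map_cons, List.count_cons,
      List.count_cons, List.count_eq_zero_of_not_mem (l := List.replicate p.2 0)]
    · omega
    · exact fun h => ha (List.eq_of_mem_replicate h)

/-- Around its third letter `1`, the full word decomposes so that replacing that letter by a
letter `h ≥ 2` is not noticeable from the second letter `1`. -/
theorem exists_decomposition {n ℓ : ℕ} {w : ℕ → List Bool} (hn : 1 ≤ n)
    (hw : FractalReq n ℓ w) : ∃ U₁ U₂ V : List ℕ,
      letters ℓ w n = U₁ ++ (1 :: U₂) ++ 1 :: V ∧ U₁.count 1 = 1 ∧ 1 ∉ U₂ ∧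
      ∀ m h, m < n → 2 ≤ h → h ≤ n →
        WordEquiv m ((1 :: U₂) ++ 1 :: V) ((1 :: U₂) ++ h :: V) := by
  obtain ⟨bls, hb, hj⟩ := hw.2.1 n hn le_rfl
  obtain ⟨d, rfl⟩ := Nat.exists_eq_add_of_le' hn
  have hs := skeleton_letters hw le_rfl
  have hd := levelSkeleton_add (d + 1 + 4) d 0
  rw [zero_add, zero_add, levelSkeleton, flatMap_replicate_eq_flatten] at hd
  rw [hd] at hs
  rw [joinUpTo_eq_map_letters hw le_rfl, List.map_eq_append_iff] at hj
  obtain ⟨u, c, hu, hub, hc⟩ := hj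
  obtain ⟨a, rfl, ha⟩ := List.map_eq_singleton_iff.1 hc
  have ha' : skeleton [a] = [a] := by simp [skeleton, ha]
  rw [hu, skeleton_append, ha'] at hs
  obtain ⟨hsk, rfl⟩ := List.append_inj' hs rfl |>.imp_right (fun h => by simpa using h)
  obtain ⟨P, rfl, hP, hg⟩ := exists_blockWord hb hub
  have hY : ∀ b ∈ gapSkeleton (d + 1 + 4) 1 d, 1 < b := fun b => lt_of_mem_gapSkeleton
  have hX := fun a => spaced_cons_gapSkeleton (d + 1 + 1) (d + 1 + 4) 1 d a
  have habs := fun m h => gapWord_absorb (m := m) (g := d + 1 + 1) (N := d + 1 + 4) (h := h)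
    (d := d) (k := 1)
  set Y := gapSkeleton (d + 1 + 4) 1 d with hYdef
  set X := gapWord (d + 1 + 1) (d + 1 + 4) 1 d with hXdef
  rw [hsk, List.replicate_succ, List.replicate_succ, List.flatten_cons, List.flatten_cons,
    List.map_eq_append_iff] at hP
  obtain ⟨P₁, P, rfl, hP₁, hP⟩ := hP
  obtain ⟨Q, R, rfl, hQ, hR⟩ := List.map_eq_append_iff.1 hP
  rw [List.replicate_succ, List.flatten_cons, List.cons_append] at hR
  obtain ⟨⟨-, g₂⟩, R, rfl, rfl, hR'⟩ := List.map_eq_cons_iff.1 hR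
  obtain ⟨⟨-, g₁⟩, Q, rfl, rfl, hQ'⟩ := List.map_eq_cons_iff.1 hQ
  have hone : Y.count 1 = 0 := List.count_eq_zero_of_not_mem fun h => (hY 1 h).false
  refine ⟨blockWord P₁, List.replicate g₁ 0 ++ blockWord Q,
    List.replicate g₂ 0 ++ blockWord R ++ [1], ?_, ?_, ?_, ?_⟩
  · rw [hu, blockWord_append, blockWord_append]
    simp [blockWord]
  · rw [count_blockWord one_ne_zero, hP₁, List.count_cons_self, hone]
  · rw [List.mem_append, not_or]
    refine ⟨fun h => one_ne_zero (List.eq_of_mem_replicate h), ?_⟩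
    rw [← List.count_eq_zero, count_blockWord one_ne_zero, hQ', hone]
  · intro m h hm h2 hh
    have key : ∀ c, WordEquiv m
        ((1 :: (List.replicate g₁ 0 ++ blockWord Q)) ++
          c :: (List.replicate g₂ 0 ++ blockWord R ++ [1]))
        (((1 :: X) ++ ((c :: X) ++ (List.replicate (d + 2) (1 :: X)).flatten)) ++ [1]) := by
      intro c
      have hb := blockWord_equiv_spaced (m := m) (g := d + 1 + 1) (by omega)
        (P := ((1, g₁) :: Q) ++ ((c, g₂) :: R)) (fun p hp => by
          simp only [List.mem_append, List.mem_cons] at hg hp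
          rcases hp with (rfl | hp) | (rfl | hp)
          · exact hg (1, g₁) (by simp)
          · exact hg p (by simp [hp])
          · exact hg (1, g₂) (by simp)
          · exact hg p (by simp [hp]))
      have e1 : blockWord (((1, g₁) :: Q) ++ ((c, g₂) :: R)) ++ [1] =
          (1 :: (List.replicate g₁ 0 ++ blockWord Q)) ++
            c :: (List.replicate g₂ 0 ++ blockWord R ++ [1]) := by
        rw [blockWord_append]; simp [blockWord]
      have e2 : spaced (d + 1 + 1) ((((1, g₁) :: Q) ++ ((c, g₂) :: R)).map Prod.fst) =
          (1 :: X) ++ ((c :: X) ++ (List.replicate (d + 2) (1 :: X)).flatten) := by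
        rw [List.map_append, List.map_cons, List.map_cons, hQ', hR', ← List.cons_append,
          spaced_append, spaced_append, spaced_flatten_replicate, hX, hX]
      rw [← e1, ← e2]
      exact hb.append (.refl m _)
    refine (key 1).trans (WordEquiv.trans ?_ (key h).symm)
    refine WordEquiv.append ?_ (.refl m _)
    have e3 : (1 :: X) ++ ((h :: X) ++ (List.replicate (d + 2) (1 :: X)).flatten) =
        (1 :: (X ++ h :: X)) ++ (List.replicate (d + 2) (1 :: X)).flatten := by simp
    have e4 : (1 :: X) ++ ((1 :: X) ++ (List.replicate (d + 2) (1 :: X)).flatten) =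
        (List.replicate (d + 4) (1 :: X)).flatten := by
      simp [List.replicate_succ]
    rw [e3, e4]
    refine WordEquiv.trans ?_
      ((((habs m h (by omega) (by omega) (by omega)).cons 1).append (.refl m _)).symm)
    exact WordEquiv.power (b := d + 3) (List.cons_ne_nil 1 X) (by omega) (by omega)

theorem append_cons_inj_of_count_eq {a : ℕ} : ∀ {u x v z : List ℕ},
    u ++ a :: v = x ++ a :: z → u.count a = x.count a → u = x ∧ v = z
  | [], [], _, _, h, _ => ⟨rfl, (List.cons.inj h).2⟩
  | [], b :: x, _, _, h, hc => by
    obtain rfl : a = b := (List.cons.inj h).1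
    simp at hc
  | b :: u, [], _, _, h, hc => by
    obtain rfl : b = a := (List.cons.inj h).1
    simp at hc
  | b :: u, c :: x, v, z, h, hc => by
    obtain ⟨rfl, h'⟩ : b = c ∧ u ++ a :: v = x ++ a :: z := by simpa using h
    rw [List.count_cons, List.count_cons, Nat.add_right_cancel_iff] at hc
    obtain ⟨rfl, rfl⟩ := append_cons_inj_of_count_eq h' hc
    exact ⟨rfl, rfl⟩

theorem count_take_eq_card {a : ℕ} (L : List ℕ) : ∀ {m : ℕ}, m ≤ L.length →
    (L.take m).count a = ((Finset.range m).filter fun i => L.getD i (a + 1) = a).card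
  | 0, _ => by simp
  | m + 1, hm => by
    rw [Finset.range_add_one, Finset.filter_insert, List.take_add_one, List.count_append,
      count_take_eq_card L (by omega), List.getElem?_eq_getElem (by omega),
      List.getD_eq_getElem _ _ (by omega)]
    split
    · rename_i h
      rw [Finset.card_insert_of_notMem (by simp)]
      simp [h]
    · rename_i h
      simp [h]

theorem count_take_of_isAlert {n ℓ ia : ℕ} {w : ℕ → List Bool} (hn : 1 ≤ n)
    (hw : FractalReq n ℓ w) (h : IsAlert ℓ (w 1) ia) :
    ((letters ℓ w n).take (ia - 1)).count 1 = 2 := by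
  obtain ⟨h1, h2, -, h4⟩ := h
  have hl := length_letters hw le_rfl
  rw [count_take_eq_card _ (by omega), ← h4]
  refine Finset.card_bij' (fun i _ => i + 1) (fun i _ => i - 1) ?_ ?_ ?_ ?_
  · intro i hi
    simp only [Finset.mem_filter, Finset.mem_range, Finset.mem_Icc] at hi ⊢
    have hg := (letters_getD_eq_iff hw i le_rfl le_rfl (j := 1)).1
    rw [List.getD_eq_getElem _ _ (by omega)] at hi hg
    exact ⟨by omega, by omega, (hg hi.2).2⟩
  · intro i hi
    simp only [Finset.mem_filter, Finset.mem_range, Finset.mem_Icc] at hi ⊢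
    have hg := (letters_getD_eq_iff hw (i - 1) le_rfl le_rfl (j := 1)).2 ⟨hn, hi.2.2⟩
    rw [List.getD_eq_getElem _ _ (by omega)] at hg ⊢
    exact ⟨by omega, hg⟩
  · intro i _
    rfl
  · intro i hi
    simp only [Finset.mem_filter, Finset.mem_Icc] at hi
    show i - 1 + 1 = i
    omega

/-- Replacing the third letter `1` by `h` is not noticeable up to any earlier occurrence of
the letter `1`. -/
theorem ltlEquiv_drop_set {n ℓ ia iF : ℕ} {w : ℕ → List Bool} (hn : 1 ≤ n)
    (hw : FractalReq n ℓ w) (ha : IsAlert ℓ (w 1) ia) (hiF : 1 ≤ iF) (hlt : iF < ia)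
    (hF : (w 1).getD (iF - 1) false = true) {m h l : ℕ} (hm : m < n) (h1 : 1 ≤ h) (hh : h ≤ n)
    (hl : l + 1 ≤ iF) (α : Stream' ℕ) :
    LTLEquiv m ((letters ℓ w n ++ₛ α).drop l)
      (((letters ℓ w n).set (ia - 1) h ++ₛ α).drop l) := by
  obtain ⟨U₁, U₂, V, hL, hU₁, hU₂, hV⟩ := exists_decomposition hn hw
  have hc := count_take_of_isAlert hn hw ha
  have hlen := length_letters hw le_rfl
  obtain ⟨ha1, ha2, ha3, -⟩ := ha
  have hget := (letters_getD_eq_iff hw (ia - 1) le_rfl le_rfl (j := 1)).2 ⟨hn, ha3⟩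
  have hgetF := (letters_getD_eq_iff hw (iF - 1) le_rfl le_rfl (j := 1)).2 ⟨hn, hF⟩
  set L := letters ℓ w n with hLdef
  rw [List.getD_eq_getElem _ _ (by omega)] at hget
  have hsplit : L = L.take (ia - 1) ++ 1 :: L.drop (ia - 1 + 1) := by
    have hd : L.drop (ia - 1) = 1 :: L.drop (ia - 1 + 1) := by
      rw [List.drop_eq_getElem_cons (by omega), hget]
    rw [← hd, List.take_append_drop]
  obtain ⟨hU, -⟩ := append_cons_inj_of_count_eq (hL.symm.trans hsplit) (by
    rw [hc, List.count_append, hU₁, List.count_cons_self, List.count_eq_zero_of_not_mem hU₂])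
  have hia : ia - 1 = (U₁ ++ 1 :: U₂).length := by
    rw [hU, List.length_take]; omega
  have hpre : iF - 1 ≤ U₁.length := by
    by_contra hcon
    have hsmall : iF - 1 < (U₁ ++ 1 :: U₂).length := by omega
    obtain ⟨i, hi⟩ := Nat.exists_eq_add_of_le (Nat.succ_le_of_lt (not_le.1 hcon))
    rw [hL, List.getD_append _ _ _ _ hsmall, List.getD_append_right _ _ _ _ (by omega),
      show iF - 1 - U₁.length = i + 1 by omega, List.getD_cons_succ] at hgetF
    rw [List.length_append, List.length_cons] at hsmall
    rw [List.getD_eq_getElem _ _ (by omega)] at hgetF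
    exact hU₂ (hgetF ▸ List.getElem_mem _)
  have hset : L.set (ia - 1) h = U₁ ++ ((1 :: U₂) ++ h :: V) := by
    rw [hL, hia, List.set_append_right _ _ le_rfl, Nat.sub_self, List.set_cons_zero,
      List.append_assoc]
  rcases Nat.eq_or_lt_of_le h1 with rfl | h2
  · rw [hset, ← List.append_assoc, ← hL]
    exact .refl m _
  · have key : ∀ W, ((U₁ ++ W) ++ₛ α).drop l = U₁.drop l ++ₛ (W ++ₛ α) := fun W => by
      rw [Stream'.append_append_stream, drop_appendStream_of_le _ _ (by omega)]
    rw [hset, hL, List.append_assoc, key, key]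
    exact (hV m h hm h2 hh α).append _

/-- If initial paths are determined by their first successor node and labels along the
admissible paths are determined by letters, then satisfaction at positive positions is
determined by the words of letters up to `LTLEquiv`. -/
theorem satT_iff_of_ltlEquiv {Var : Type} [DecidableEq Var] {T M : TreeKripke Unit}
    (hE : M.edge = T.edge)
    (huniq : ∀ π π', T.TInit π → T.TInit π' → π 1 = π' 1 → π = π')
    {S : Set (ℕ → List ℕ)} (hS : ∀ π ∈ S, T.TInit π) {σ τ : Stream' ℕ}
    (hV : ∀ π ∈ S, ∀ i j, σ.get i = τ.get j → (() ∈ T.V (π (i + 1)) ↔ () ∈ M.V (π (j + 1)))) :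
    ∀ (ψ : HCTLs Unit Var) (A : Var → ℕ → List ℕ) (y : Var) (i j : ℕ), (∀ x, A x ∈ S) →
      LTLEquiv ψ.size (σ.drop i) (τ.drop j) →
      (ψ.satT T A y (i + 1) ↔ ψ.satT M A y (j + 1))
  | .tt, _, _, _, _, _, _ => Iff.rfl
  | .atom _ x, A, _, i, j, hA, h => by
    refine hV _ (hA x) i j ?_
    have := h.head_eq
    rwa [Stream'.head_drop, Stream'.head_drop] at this
  | .neg φ, A, y, i, j, hA, h =>
    not_congr (satT_iff_of_ltlEquiv hE huniq hS hV φ A y i j hA (h.mono (Nat.le_succ _)))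
  | .conj φ ψ, A, y, i, j, hA, h =>
    and_congr
      (satT_iff_of_ltlEquiv hE huniq hS hV φ A y i j hA
        (h.mono (by simp only [HCTLs.size]; omega)))
      (satT_iff_of_ltlEquiv hE huniq hS hV ψ A y i j hA
        (h.mono (by simp only [HCTLs.size]; omega)))
  | .next φ, A, y, i, j, hA, h => by
    obtain ⟨-, h, -⟩ := h
    rw [Stream'.tail_drop', Stream'.tail_drop'] at h
    exact satT_iff_of_ltlEquiv hE huniq hS hV φ A y (i + 1) (j + 1) hA h
  | .untl φ ψ, A, y, i, j, hA, h => by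
    obtain ⟨-, -, h1, h2⟩ := h
    have ihφ : ∀ i j, LTLEquiv (φ.size + ψ.size) (σ.drop i) (τ.drop j) →
        (φ.satT T A y (i + 1) ↔ φ.satT M A y (j + 1)) := fun i j h =>
      satT_iff_of_ltlEquiv hE huniq hS hV φ A y i j hA (h.mono (Nat.le_add_right _ _))
    have ihψ : ∀ i j, LTLEquiv (φ.size + ψ.size) (σ.drop i) (τ.drop j) →
        (ψ.satT T A y (i + 1) ↔ ψ.satT M A y (j + 1)) := fun i j h =>
      satT_iff_of_ltlEquiv hE huniq hS hV ψ A y i j hA (h.mono (Nat.le_add_left _ _))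
    simp only [Stream'.drop_drop] at h1 h2
    constructor
    · rintro ⟨e, he, hψ, hφ⟩
      obtain ⟨d, rfl⟩ := Nat.exists_eq_add_of_le he
      obtain ⟨d', hd, hk⟩ := h1 d
      refine ⟨j + d' + 1, by omega, ?_, fun k hk1 hk2 => ?_⟩
      · rw [← ihψ _ _ hd, Nat.add_right_comm]
        exact hψ
      · obtain ⟨k', rfl⟩ := Nat.exists_eq_add_of_le hk1
        obtain ⟨k, hk3, hk4⟩ := hk k' (by omega)
        rw [Nat.add_right_comm, ← ihφ _ _ hk4]
        exact hφ _ (by omega) (by omega)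
    · rintro ⟨e, he, hψ, hφ⟩
      obtain ⟨d, rfl⟩ := Nat.exists_eq_add_of_le he
      obtain ⟨d', hd, hk⟩ := h2 d
      refine ⟨i + d' + 1, by omega, ?_, fun k hk1 hk2 => ?_⟩
      · rw [ihψ _ _ hd, Nat.add_right_comm]
        exact hψ
      · obtain ⟨k', rfl⟩ := Nat.exists_eq_add_of_le hk1
        obtain ⟨k, hk3, hk4⟩ := hk k' (by omega)
        rw [Nat.add_right_comm, ihφ _ _ hk4]
        exact hφ _ (by omega) (by omega)
  | .ex x φ, A, y, i, j, hA, h => by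
    have hA' : ∀ z, Function.update A x (A y) z ∈ S := fun z => by
      rw [Function.update_apply]
      split <;> exact hA _
    have ih := satT_iff_of_ltlEquiv hE huniq hS hV φ (Function.update A x (A y)) x i j hA'
      (h.mono (Nat.le_succ _))
    have hM : ∀ π, M.TInit π ↔ T.TInit π := fun π => by
      rw [TreeKripke.TInit, TreeKripke.TInit, hE]
    constructor
    · rintro ⟨π, hπ, hagree, hφ⟩
      obtain rfl := huniq π (A y) hπ (hS _ (hA y)) (hagree 1 (by omega))
      exact ⟨A y, (hM _).2 hπ, fun _ _ => rfl, ih.1 hφ⟩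
    · rintro ⟨π, hπ, hagree, hφ⟩
      obtain rfl := huniq π (A y) ((hM _).1 hπ) (hS _ (hA y)) (hagree 1 (by omega))
      exact ⟨A y, (hM _).1 hπ, fun _ _ => rfl, ih.2 hφ⟩

theorem TreeKripke.TInit.length_eq {AP : Type} {T : TreeKripke AP} {π : ℕ → List ℕ}
    (h : T.TInit π) : ∀ i, (π i).length = i
  | 0 => by rw [h.1]; rfl
  | i + 1 => by
    obtain ⟨a, ha⟩ := T.edge_child (h.2 i)
    rw [ha, List.length_append, h.length_eq i]
    rfl

theorem TreeKripke.TInit.apply_one_eq_take {AP : Type} {T : TreeKripke AP} {π : ℕ → List ℕ}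
    (h : T.TInit π) : ∀ i, π 1 = (π (i + 1)).take 1
  | 0 => by rw [List.take_of_length_le (h.length_eq 1).le]
  | i + 1 => by
    obtain ⟨a, ha⟩ := T.edge_child (h.2 (i + 1))
    rw [ha, List.take_append_of_le_length (by rw [h.length_eq]; omega)]
    exact h.apply_one_eq_take i

theorem TreeKripke.length_eq_one_of_edge {AP : Type} {T : TreeKripke AP} {τ : List ℕ}
    (h : T.edge [] τ) : τ.length = 1 := by
  obtain ⟨a, rfl⟩ := T.edge_child h
  rfl

theorem TreeKripke.TInit.apply_one_of_visits {AP : Type} {T : TreeKripke AP} {π : ℕ → List ℕ}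
    (h : T.TInit π) {τ : List ℕ} (hτ : T.edge [] τ) (hv : ∃ i, π i = τ) : π 1 = τ := by
  obtain ⟨i, rfl⟩ := hv
  have := TreeKripke.length_eq_one_of_edge hτ
  rw [h.length_eq] at this
  rw [this]

theorem get_appendStream_const (u : List ℕ) : ∀ i,
    (u ++ₛ Stream'.const 0).get i = u.getD i 0 := by
  induction u with
  | nil => intro i; rfl
  | cons a u ih =>
    intro i
    rcases i with _ | i
    · rfl
    · exact ih i

namespace KLTLKnData

theorem pXi_one {n ℓ : ℕ} {T : TreeKripke Unit} (D : KLTLKnData n T ℓ)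
    {k : ℕ} (h1 : 1 ≤ k) (hk : k ≤ n) : D.pXi k 1 = D.xi k :=
  (D.pXi_init k h1 hk).apply_one_of_visits (D.edge_xi k h1 hk) (D.pXi_visits k h1 hk)

theorem pEta_one {n ℓ : ℕ} {T : TreeKripke Unit} (D : KLTLKnData n T ℓ) : D.pEta 1 = D.eta :=
  D.pEta_init.apply_one_of_visits D.edge_eta D.pEta_visits

theorem eq_pEta_or_pXi {n ℓ : ℕ} {T : TreeKripke Unit} (D : KLTLKnData n T ℓ)
    {π : ℕ → List ℕ} (h : T.TInit π) :
    π = D.pEta ∨ ∃ k, 1 ≤ k ∧ k ≤ n ∧ π = D.pXi k := by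
  have he := h.2 0
  rw [h.1] at he
  rcases D.succ_only _ he with h1 | ⟨k, h1, hk, h2⟩
  · exact .inl (D.pEta_unique π h ⟨1, h1⟩)
  · exact .inr ⟨k, h1, hk, D.pXi_unique k h1 hk π h ⟨1, h2⟩⟩

theorem ext_of_apply_one {n ℓ : ℕ} {T : TreeKripke Unit} (D : KLTLKnData n T ℓ)
    {π π' : ℕ → List ℕ} (h : T.TInit π) (h' : T.TInit π')
    (he : π 1 = π' 1) : π = π' := by
  have key := h.2 0
  rw [h.1] at key
  rcases D.succ_only _ key with h1 | ⟨k, hk1, hk, h1⟩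
  · rw [D.pEta_unique π h ⟨1, h1⟩, D.pEta_unique π' h' ⟨1, he ▸ h1⟩]
  · rw [D.pXi_unique k hk1 hk π h ⟨1, h1⟩, D.pXi_unique k hk1 hk π' h' ⟨1, he ▸ h1⟩]

theorem pXi_injOn {n ℓ : ℕ} {T : TreeKripke Unit} (D : KLTLKnData n T ℓ)
    : Set.InjOn D.pXi (Set.Icc 1 n) := by
  intro k hk k' hk' h
  refine D.xi_inj k k' hk.1 hk.2 hk'.1 hk'.2 ?_
  rw [← D.pXi_one hk.1 hk.2, ← D.pXi_one hk'.1 hk'.2, h]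

theorem finite_of_forall_tInit {n ℓ : ℕ} {T : TreeKripke Unit} (D : KLTLKnData n T ℓ)
    {S : Set (ℕ → List ℕ)} (hS : ∀ π ∈ S, T.TInit π) :
    S.Finite := by
  refine ((Set.finite_Icc 1 n).image D.pXi |>.insert D.pEta).subset fun π hπ => ?_
  rcases D.eq_pEta_or_pXi (hS π hπ) with rfl | ⟨k, h1, hk, rfl⟩
  · exact Set.mem_insert _ _
  · exact Set.mem_insert_of_mem _ ⟨k, ⟨h1, hk⟩, rfl⟩

theorem exists_pXi_notMem {n ℓ : ℕ} {T : TreeKripke Unit} (D : KLTLKnData n T ℓ)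
    {S : Set (ℕ → List ℕ)} (hS : ∀ π ∈ S, T.TInit π)
    (hc : S.ncard < n) : ∃ h, 1 ≤ h ∧ h ≤ n ∧ D.pXi h ∉ S := by
  by_contra! hcon
  have hsub : D.pXi '' Set.Icc 1 n ⊆ S := by
    rintro _ ⟨k, hk, rfl⟩
    exact hcon k hk.1 hk.2
  have hle := Set.ncard_le_ncard hsub (D.finite_of_forall_tInit hS)
  rw [D.pXi_injOn.ncard_image, Set.ncard_eq_toFinset_card', Set.toFinset_Icc,
    Nat.card_Icc] at hle
  omega

theorem mem_V_pXi_iff {n ℓ : ℕ} {T : TreeKripke Unit} (D : KLTLKnData n T ℓ)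
    {k : ℕ} (h1 : 1 ≤ k) (hk : k ≤ n) (i : ℕ) :
    () ∈ T.V (D.pXi k (i + 1)) ↔ (letters ℓ D.w n).getD i 0 = k := by
  rw [letters_getD_eq_iff D.fractal i h1 le_rfl]
  rcases lt_or_ge i ℓ with hi | hi
  · rw [D.trace_xi₁ k h1 hk (i + 1) (by omega) hi, Nat.add_sub_cancel]
    exact (and_iff_right hk).symm
  · refine iff_of_false (D.trace_xi₂ k h1 hk (i + 1) (by omega)) ?_
    rw [List.getD_eq_default _ _ (by rw [D.fractal.1 k h1 hk]; exact hi)]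
    simp

theorem mem_V_pEta_iff {n ℓ : ℕ} {T : TreeKripke Unit} (D : KLTLKnData n T ℓ) (hn : 1 ≤ n) (i : ℕ) :
    () ∈ T.V (D.pEta (i + 1)) ↔ (letters ℓ D.w n).getD i 0 = 0 := by
  have hl := length_letters D.fractal le_rfl
  rcases lt_or_ge i ℓ with hi | hi
  · rw [D.trace_eta₁ (i + 1) (by omega) hi, Nat.add_sub_cancel, D.w0_dual]
    obtain ⟨d, rfl⟩ := Nat.exists_eq_add_of_le' hn
    rw [joinUpTo_eq_map_letters D.fractal le_rfl, List.getD_eq_getElem _ _ (by simp; omega),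
      List.getD_eq_getElem _ _ (by omega)]
    simp
  · refine iff_of_true (D.trace_eta₂ (i + 1) (by omega)) ?_
    rw [List.getD_eq_default _ _ (by omega)]

/-- At positive positions up to `i_F`, the formula cannot distinguish `K_n` from `M_n` if
the paths in use leave out one of the paths `π(ξ_h)`. -/
theorem satT_iff_of_pos {n ℓ : ℕ} {T : TreeKripke Unit} (D : KLTLKnData n T ℓ)
    {Var : Type} [DecidableEq Var] (hn : 1 ≤ n) {ia : ℕ}
    (ha : IsAlert ℓ (D.w 1) ia) {M : TreeKripke Unit} (hM : MObtainedKLTL M D ia) {iF : ℕ}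
    (hiF : 1 ≤ iF) (hlt : iF < ia) (hF : (D.w 1).getD (iF - 1) false = true)
    {ψ : HCTLs Unit Var} {A : Var → ℕ → List ℕ} (hA : ∀ x, T.TInit (A x))
    (hc : (Set.range A).ncard < n) (hψ : ψ.size < n) {l : ℕ} (hl : l + 1 ≤ iF) (x : Var) :
    ψ.satT T A x (l + 1) ↔ ψ.satT M A x (l + 1) := by
  obtain ⟨h, h1, hh, hmem⟩ := D.exists_pXi_notMem (S := Set.range A)
    (by rintro _ ⟨x, rfl⟩; exact hA x) hc
  have hS : ∀ π ∈ Set.range A, T.TInit π := by rintro _ ⟨x, rfl⟩; exact hA x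
  refine satT_iff_of_ltlEquiv hM.2.1 (fun π π' => D.ext_of_apply_one) hS
    (σ := letters ℓ D.w n ++ₛ Stream'.const 0)
    (τ := (letters ℓ D.w n).set (ia - 1) h ++ₛ Stream'.const 0) ?_ ψ A x l l
    (fun x => Set.mem_range_self x)
    (ltlEquiv_drop_set hn D.fractal ha hiF hlt hF hψ h1 hh hl _)
  have hlen := length_letters D.fractal le_rfl
  obtain ⟨ha1, ha2, ha3, -⟩ := ha
  have hget := (letters_getD_eq_iff D.fractal (ia - 1) le_rfl le_rfl (j := 1)).2 ⟨hn, ha3⟩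
  intro π hπ i j hij
  have hset : ((letters ℓ D.w n).set (ia - 1) h).getD j 0 =
      if j = ia - 1 then h else (letters ℓ D.w n).getD j 0 := by
    rw [List.getD_eq_getElem?_getD, List.getElem?_set]
    split
    · rename_i hj
      rw [if_pos (by omega), if_pos hj.symm]
      rfl
    · rename_i hj
      rw [if_neg (Ne.symm hj), List.getD_eq_getElem?_getD]
  rw [get_appendStream_const, get_appendStream_const, hset] at hij
  have hinit := hS π hπ
  have hpi1 := D.pXi_init 1 le_rfl hn
  have hVM : () ∈ M.V (π (j + 1)) ↔ ¬ (π (j + 1) = D.pXi 1 ia) ∧ () ∈ T.V (π (j + 1)) := by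
    rw [hM.2.2]
    split <;> simp_all
  have hnode : π (j + 1) = D.pXi 1 ia ↔ j = ia - 1 ∧ π = D.pXi 1 := by
    constructor
    · intro he
      have hj : j + 1 = ia := by
        have := congrArg List.length he
        rwa [hinit.length_eq, hpi1.length_eq] at this
      subst hj
      refine ⟨rfl, D.ext_of_apply_one hinit hpi1 ?_⟩
      rw [hinit.apply_one_eq_take j, hpi1.apply_one_eq_take j, he]
    · rintro ⟨rfl, rfl⟩
      rw [Nat.sub_add_cancel ha1]
  rw [hVM, hnode]
  have hne : π ≠ D.pXi h := fun he => hmem (he ▸ hπ)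
  rcases D.eq_pEta_or_pXi hinit with rfl | ⟨k, hk1, hk, rfl⟩
  · have hne1 : D.pEta ≠ D.pXi 1 := fun he => D.eta_ne_xi 1 le_rfl hn (by
      rw [← D.pEta_one, ← D.pXi_one le_rfl hn, he])
    rw [D.mem_V_pEta_iff hn, D.mem_V_pEta_iff hn, hij]
    split
    · rename_i hj
      subst hj
      rw [hget]
      simp
      omega
    · simp [hne1]
  · have hkh : k ≠ h := fun he => hne (he ▸ rfl)
    have hk1' : D.pXi k = D.pXi 1 ↔ k = 1 :=
      ⟨fun he => D.pXi_injOn ⟨hk1, hk⟩ ⟨le_rfl, hn⟩ he, fun he => he ▸ rfl⟩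
    rw [D.mem_V_pXi_iff hk1 hk, D.mem_V_pXi_iff hk1 hk, hij, hk1']
    split
    · rename_i hj
      subst hj
      rw [hget]
      constructor
      · exact fun he => absurd he.symm hkh
      · rintro ⟨h3, h4⟩
        exact absurd ⟨rfl, h4.symm⟩ h3
    · rename_i hj
      simp [hj]

end KLTLKnData

theorem HCTLs.satT_untl_iff {AP Var : Type} [DecidableEq Var] (T : TreeKripke AP)
    (φ ψ : HCTLs AP Var) (A : Var → ℕ → List ℕ) (y : Var) (i : ℕ) :
    (HCTLs.untl φ ψ).satT T A y i ↔
      ψ.satT T A y i ∨ (φ.satT T A y i ∧ (HCTLs.untl φ ψ).satT T A y (i + 1)) := by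
  constructor
  · rintro ⟨j, hij, hψ, hφ⟩
    rcases Nat.eq_or_lt_of_le hij with rfl | hlt
    · exact .inl hψ
    · exact .inr ⟨hφ i le_rfl hlt, j, hlt, hψ, fun k hk => hφ k (Nat.le_of_succ_le hk)⟩
  · rintro (hψ | ⟨hφ, j, hij, hψ, hφ'⟩)
    · exact ⟨i, le_rfl, hψ, fun k hk hk' => absurd hk (not_le.2 hk')⟩
    · refine ⟨j, Nat.le_of_succ_le hij, hψ, fun k hk hkj => ?_⟩
      rcases Nat.eq_or_lt_of_le hk with rfl | hlt
      · exact hφ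
      · exact hφ' k hlt hkj

/-- Indistinguishability at position `0`. -/
theorem KLTLKnData.satT_zero_iff {Var : Type} [DecidableEq Var] {n ℓ : ℕ}
    {T : TreeKripke Unit} (D : KLTLKnData n T ℓ) (hn : 1 ≤ n) {ia : ℕ}
    (ha : IsAlert ℓ (D.w 1) ia) {M : TreeKripke Unit} (hM : MObtainedKLTL M D ia) {iF : ℕ}
    (hiF : 1 ≤ iF) (hlt : iF < ia) (hF : (D.w 1).getD (iF - 1) false = true) :
    ∀ (ψ : HCTLs Unit Var) (A : Var → ℕ → List ℕ), (∀ x, T.TInit (A x)) →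
      (Set.range A).ncard + ψ.size < n → ∀ x, (ψ.satT T A x 0 ↔ ψ.satT M A x 0) := by
  have hpos := fun (ψ : HCTLs Unit Var) (A : Var → ℕ → List ℕ) (hA : ∀ x, T.TInit (A x))
      (hc : (Set.range A).ncard + ψ.size < n) =>
    D.satT_iff_of_pos hn ha hM hiF hlt hF hA (by omega) (ψ := ψ) (by omega) (l := 0) hiF
  intro ψ
  induction ψ with
  | tt => exact fun _ _ _ _ => Iff.rfl
  | atom p y =>
    intro A hA _ x
    have h0 : A y 0 ≠ D.pXi 1 ia := fun he => by
      have := congrArg List.length he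
      rw [(hA y).length_eq, (D.pXi_init 1 le_rfl hn).length_eq] at this
      omega
    rw [HCTLs.satT, HCTLs.satT, hM.2.2, if_neg h0]
  | neg φ ih =>
    intro A hA hc x
    exact not_congr (ih A hA (by simp only [HCTLs.size] at hc; omega) x)
  | conj φ ψ ihφ ihψ =>
    intro A hA hc x
    simp only [HCTLs.size] at hc
    exact and_congr (ihφ A hA (by omega) x) (ihψ A hA (by omega) x)
  | next φ _ =>
    intro A hA hc x
    exact hpos φ A hA (by simp only [HCTLs.size] at hc; omega) x
  | untl φ ψ ihφ ihψ =>
    intro A hA hc x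
    have h1 := hpos _ A hA hc x
    simp only [HCTLs.size] at hc
    rw [HCTLs.satT_untl_iff, HCTLs.satT_untl_iff M, ihφ A hA (by omega) x,
      ihψ A hA (by omega) x, h1]
  | ex y φ ih =>
    intro A hA hc x
    simp only [HCTLs.size] at hc
    have hTM : ∀ π, M.TInit π ↔ T.TInit π := fun π => by
      rw [TreeKripke.TInit, TreeKripke.TInit, hM.2.1]
    refine exists_congr fun π => ?_
    rw [hTM]
    refine and_congr_right fun hπ => and_congr_right fun _ => ih _ (fun z => ?_) ?_ y
    · rw [Function.update_apply]
      split
      · exact hπ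
      · exact hA z
    · have hsub : Set.range (Function.update A y π) ⊆ insert π (Set.range A) := by
        rintro _ ⟨z, rfl⟩
        rw [Function.update_apply]
        split
        · exact Set.mem_insert _ _
        · exact Set.mem_insert_of_mem _ ⟨z, rfl⟩
      have hfin : (Set.range A).Finite :=
        D.finite_of_forall_tInit (by rintro _ ⟨z, rfl⟩; exact hA z)
      have := (Set.ncard_le_ncard hsub (hfin.insert π)).trans (Set.ncard_insert_le _ _)
      omega

/-- **Up to `i_F`, `K_n` and `M_n` are indistinguishable by HyperCTL\* formulas `ψ`
and path assignments `Π` with `|Π| + |ψ| < n`**, where `i_F` is the first position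
of the pure macro-block of type `ξ_1` whose last position is `i_alert`. -/
theorem Kn_Mn_indistinguishable_up_to_iF (Var : Type) [DecidableEq Var] :
    ∀ n : ℕ, 1 < n → ∀ T : TreeKripke Unit, IsRegularTree T →
      ∀ ℓ : ℕ, 1 < ℓ → ∀ D : KLTLKnData n T ℓ,
        ∀ ia : ℕ, IsAlert ℓ (D.w 1) ia →
          ∀ M : TreeKripke Unit, MObtainedKLTL M D ia →
            ∀ iF : ℕ,
              (iF < ia ∧ HType n ℓ D.w ia 1 iF 1 ∧ HType n ℓ D.w ia 1 ia 1 ∧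
                ∀ m r, iF < m → m < ia → HType n ℓ D.w ia 1 m r → 1 < r) →
              ∀ (ψ : HCTLs Unit Var) (A : Var → (ℕ → List ℕ)),
                (∀ x, T.TInit (A x)) →
                (Set.range A).ncard + HCTLs.size ψ < n →
                ∀ l, l ≤ iF → ∀ x,
                  (HCTLs.satT T ψ A x l ↔ HCTLs.satT M ψ A x l) := by

  intro n hn T _ ℓ _ D ia ha M hM iF hiF ψ A hA hc l hl x
  obtain ⟨hlt, hFtype, -, -⟩ := hiF
  obtain ⟨⟨hF1, -⟩, -, -, hF⟩ : HasType n ℓ D.w iF 1 := by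
    rcases hFtype with ⟨h, -⟩ | ⟨-, h⟩
    · exact absurd rfl h
    · exact h
  rcases l with _ | l
  · exact D.satT_zero_iff hn.le ha hM hF1 hlt hF ψ A hA hc x
  · exact D.satT_iff_of_pos hn.le ha hM hF1 hlt hF hA (by omega) (by omega) hl x
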